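/- Let n ∈ ℝ³ with ‖n‖ = 1, d ∈ ℝ with d ≠ 0, and Π = d·n. Let n⊥₁, n⊥₂ ∈ ℝ³ be such that {n⊥₁, n⊥₂, n} is orthonormal. Let g, P₁, V₁, P_k ∈ ℝ³, δt ∈ ℝ, let R₁ be a rotation matrix, and let A, B ∈ ℝ³ˣ³ be arbitrary. Define Γ_{π1} = ((d − nᵀP_k)⌊n×⌋ − nnᵀ⌊(P₁ + V₁δt − ½δt²g − P_k)×⌋)R₁ and Γ_{π4} = ((d − nᵀP_k)I₃ − nP_kᵀ + 2(nᵀP_k)nnᵀ)/d, and the 3×18 block matrix M = [Γ_{π1}, A, −δt·nnᵀ, B, −nnᵀ, Γ_{π4}]. Let N_π ∈ ℝ¹⁸ˣ⁷ have: column 1 = (R₁ᵀg; 0; −⌊V₁×⌋g; 0; −⌊P₁×⌋g; −⌊Π×⌋g); columns 2–4 given by stacked blocks (0; 0; 0; 0; [n⊥₁, n⊥₂, n]; n·e₃ᵀ); column 5 = (0; 0; n⊥₁; 0; 0; 0); column 6 = (0; 0; n⊥₂; 0; 0; 0); column 7 = (R₁ᵀn; 0; 0; 0; 0; 0). Then M·N_π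 = 0. Hence the linearized aided INS with a single plane feature in closest-point parameterization has at least 7 unobservable directions: rotation about gravity, global translation, the two translational velocities parallel to the plane, and rotation about the plane normal. -/

import Mathlib

open Matrix

noncomputable section

abbrev V3 : Type := Fin 3 → ℝ
abbrev M3 : Type := Matrix (Fin 3) (Fin 3) ℝ

/-- The skew-symmetric cross-product matrix `⌊v×⌋`. -/
def skew (v : V3) : M3 :=
  !![0, -(v 2), v 1; v 2, 0, -(v 0); -(v 1), v 0, 0]

/-- `R` is a rotation matrix: `RᵀR = I₃` and `det R = 1`. -/
def IsRot (R : M3) : Prop := Rᵀ * R = 1 ∧ R.det = 1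

/-- Euclidean norm on `ℝ³`. -/
def norm3 (v : V3) : ℝ := Real.sqrt (v ⬝ᵥ v)

def e1 : V3 := ![1, 0, 0]
def e2 : V3 := ![0, 1, 0]
def e3 : V3 := ![0, 0, 1]

/-- The 3×3 matrix with the given columns. -/
def cols3 (a b c : V3) : M3 := Matrix.of fun i j => ![a i, b i, c i] j

/-- The 3×3 matrix with the given rows. -/
def rows3 (a b c : V3) : M3 := Matrix.of ![a, b, c]

/-- 18-dimensional aided-INS state index:
(orientation, gyro bias, velocity, accel bias, position, feature). -/
abbrev S18 : Type := Fin 3 ⊕ Fin 3 ⊕ Fin 3 ⊕ Fin 3 ⊕ Fin 3 ⊕ Fin 3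

/-- The 3×18 block row `[A B C D E F]`. -/
def row6 (A B C D E F : M3) : Matrix (Fin 3) S18 ℝ :=
  Matrix.of fun i =>
    Sum.elim (fun j => A i j) (Sum.elim (fun j => B i j) (Sum.elim (fun j => C i j)
      (Sum.elim (fun j => D i j) (Sum.elim (fun j => E i j) (fun j => F i j)))))

/-- The stacked vector `(a; b; c; d; e; f)` in ℝ¹⁸. -/
def col6 (a b c d e f : V3) : S18 → ℝ :=
  Sum.elim a (Sum.elim b (Sum.elim c (Sum.elim d (Sum.elim e f))))

/-- The 18×3 stacked blocks `(A; B; C; D; E; F)`. -/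
def stack6 (A B C D E F : M3) : Matrix S18 (Fin 3) ℝ :=
  Matrix.of (Sum.elim (fun i => A i) (Sum.elim (fun i => B i) (Sum.elim (fun i => C i)
    (Sum.elim (fun i => D i) (Sum.elim (fun i => E i) (fun i => F i))))))


theorem row6_mulVec_col6 (A B C D E F : M3) (a b c d e f : V3) :
    row6 A B C D E F *ᵥ col6 a b c d e f =
      A *ᵥ a + B *ᵥ b + C *ᵥ c + D *ᵥ d + E *ᵥ e + F *ᵥ f := by
  ext i
  simp [row6, col6, mulVec, dotProduct, Fintype.sum_sum_type, add_assoc]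

theorem skew_mulVec (v w : V3) : skew v *ᵥ w = crossProduct v w := by
  ext i
  fin_cases i <;> simp [skew, cross_apply, mulVec, dotProduct, Fin.sum_univ_three] <;> ring

theorem IsRot.mul_mulVec_transpose {R : M3} (hR : IsRot R) (C : M3) (v : V3) :
    (C * R) *ᵥ (Rᵀ *ᵥ v) = C *ᵥ v := by
  rw [mulVec_mulVec, Matrix.mul_assoc, mul_eq_one_comm.mp hR.1, Matrix.mul_one]

theorem dotProduct_self_of_norm3_eq_one {n : V3} (hn : norm3 n = 1) : n ⬝ᵥ n = 1 :=
  Real.sqrt_eq_one.mp hn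

theorem stack6_apply_eq_col6 (A B C D E F : M3) (s : S18) (j : Fin 3) :
    stack6 A B C D E F s j =
      col6 (A.col j) (B.col j) (C.col j) (D.col j) (E.col j) (F.col j) s := by
  rcases s with s | s | s | s | s | s <;> rfl

/-- the linearized aided INS with a single plane feature in
closest-point parameterization has at least 7 unobservable directions. -/
theorem single_plane_unobservable_directions
    (n np1 np2 g P₁ V₁ Pk : V3) (d δt : ℝ) (R₁ : M3) (hR₁ : IsRot R₁)
    (hn : norm3 n = 1) (hd : d ≠ 0)
    (h11 : np1 ⬝ᵥ np1 = 1) (h22 : np2 ⬝ᵥ np2 = 1) (h12 : np1 ⬝ᵥ np2 = 0)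
    (h1n : np1 ⬝ᵥ n = 0) (h2n : np2 ⬝ᵥ n = 0)
    (A B : M3) :
    let cp : V3 := d • n
    let Γπ1 : M3 := ((d - n ⬝ᵥ Pk) • skew n
        - vecMulVec n n * skew (P₁ + δt • V₁ - (δt ^ 2 / 2) • g - Pk)) * R₁
    let Γπ4 : M3 := d⁻¹ • ((d - n ⬝ᵥ Pk) • (1 : M3) - vecMulVec n Pk
        + (2 * (n ⬝ᵥ Pk)) • vecMulVec n n)
    let M : Matrix (Fin 3) S18 ℝ :=
      row6 Γπ1 A ((-δt) • vecMulVec n n) B (-(vecMulVec n n)) Γπ4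
    let Nπ : Matrix S18 (Fin 1 ⊕ Fin 3 ⊕ Fin 1 ⊕ Fin 1 ⊕ Fin 1) ℝ :=
      Matrix.of fun s => Sum.elim
        (fun _ : Fin 1 =>
          col6 (R₁ᵀ *ᵥ g) 0 (-(skew V₁ *ᵥ g)) 0 (-(skew P₁ *ᵥ g)) (-(skew cp *ᵥ g)) s)
        (Sum.elim
          (fun j : Fin 3 => stack6 0 0 0 0 (cols3 np1 np2 n) (vecMulVec n e3) s j)
          (Sum.elim (fun _ : Fin 1 => col6 0 0 np1 0 0 0 s)
            (Sum.elim (fun _ : Fin 1 => col6 0 0 np2 0 0 0 s)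
              (fun _ : Fin 1 => col6 (R₁ᵀ *ᵥ n) 0 0 0 0 0 s))))
    M * Nπ = 0 := by
  intro cp Γπ1 Γπ4 M Nπ
  have hnn := dotProduct_self_of_norm3_eq_one hn
  ext i j
  rcases j with j | j | j | j | j
  · change (M *ᵥ col6 (R₁ᵀ *ᵥ g) 0 (-(skew V₁ *ᵥ g)) 0 (-(skew P₁ *ᵥ g))
      (-(skew cp *ᵥ g))) i = 0
    simp only [M, Γπ1, Γπ4, cp, row6_mulVec_col6, hR₁.mul_mulVec_transpose]
    have htriple : n ⬝ᵥ crossProduct Pk g = -(Pk ⬝ᵥ crossProduct n g) := by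
      rw [triple_product_permutation, ← cross_anticomm, dotProduct_neg]
    simp [sub_mulVec, add_mulVec, smul_mulVec, neg_mulVec, mulVec_neg, ← mulVec_mulVec,
      skew_mulVec, vecMulVec_mulVec, htriple, -cross_anticomm]
    field_simp
    ring
  · have hcol : (fun s => Nπ s (Sum.inr (Sum.inl j))) =
        col6 0 0 0 0 ((cols3 np1 np2 n).col j) ((vecMulVec n e3).col j) :=
      funext fun s => stack6_apply_eq_col6 0 0 0 0 _ _ s j
    change (M *ᵥ fun s => Nπ s (Sum.inr (Sum.inl j))) i = 0
    rw [hcol]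
    simp only [M, row6_mulVec_col6]
    have h0 : (cols3 np1 np2 n).col j = ![np1, np2, n] j := by
      fin_cases j <;> rfl
    have h1 : (vecMulVec n e3).col j = e3 j • n := by
      ext k; simp [vecMulVec_apply, mul_comm]
    rw [h0, h1]
    fin_cases j
    · simp [e3, neg_mulVec, vecMulVec_mulVec, dotProduct_comm n, h1n]
    · simp [e3, neg_mulVec, vecMulVec_mulVec, dotProduct_comm n, h2n]
    · simp [Γπ4, e3, neg_mulVec, sub_mulVec, add_mulVec, smul_mulVec, vecMulVec_mulVec, hnn,
        dotProduct_comm Pk]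
      field_simp
      ring
  · change (M *ᵥ col6 0 0 np1 0 0 0) i = 0
    simp [M, row6_mulVec_col6, neg_mulVec, smul_mulVec, vecMulVec_mulVec, dotProduct_comm n, h1n]
  · change (M *ᵥ col6 0 0 np2 0 0 0) i = 0
    simp [M, row6_mulVec_col6, neg_mulVec, smul_mulVec, vecMulVec_mulVec, dotProduct_comm n, h2n]
  · change (M *ᵥ col6 (R₁ᵀ *ᵥ n) 0 0 0 0 0) i = 0
    simp only [M, Γπ1, row6_mulVec_col6, hR₁.mul_mulVec_transpose]
    simp [sub_mulVec, smul_mulVec, ← mulVec_mulVec, skew_mulVec, vecMulVec_mulVec]
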